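/- There exists a universal constant C > 0 such that for every finite regular graph Γ = (V,E) and every integer n with 2 ≤ n ≤ |V|, one has C·n^6·λ_n(Γ) ≥ (√(ι_n(Γ)/n + 1) − 1)^2. -/

import Mathlib

open scoped Pointwise

namespace Multiway

variable {V : Type*}

/-- The edge boundary `∂A`: the set of edges with one endpoint in `A` and the other in `Vᶜ∖A`. -/
def edgeBdry (G : SimpleGraph V) (A : Set V) : Set (Sym2 V) :=
  {e | e ∈ G.edgeSet ∧ ∃ u v, e = s(u, v) ∧ u ∈ A ∧ v ∉ A}

/-- The symmetric vertex boundary `δA`: vertices incident to an edge crossing `A`. -/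
def vertBdry (G : SimpleGraph V) (A : Set V) : Set V :=
  {x | ∃ y, G.Adj x y ∧ ¬ (x ∈ A ↔ y ∈ A)}

/-- A partition of the vertex set into `n` non-empty pairwise disjoint sets. -/
def IsNPartition (n : ℕ) (A : Fin n → Set V) : Prop :=
  (∀ i, (A i).Nonempty) ∧ (∀ i j, i ≠ j → Disjoint (A i) (A j)) ∧ (⋃ i, A i) = Set.univ

/-- `max_i |∂A_i| / |A_i|`. -/
noncomputable def edgeRatioMax (G : SimpleGraph V) {n : ℕ} (A : Fin n → Set V) : ℝ :=
  ⨆ i, ((edgeBdry G (A i)).ncard : ℝ) / ((A i).ncard : ℝ)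

/-- `max_i |δA_i| / |A_i|`. -/
noncomputable def vertRatioMax (G : SimpleGraph V) {n : ℕ} (A : Fin n → Set V) : ℝ :=
  ⨆ i, ((vertBdry G (A i)).ncard : ℝ) / ((A i).ncard : ℝ)

/-- The `n`-way isoperimetric constant `h_n(Γ)`. -/
noncomputable def multiH (G : SimpleGraph V) (n : ℕ) : ℝ :=
  sInf {r | ∃ A : Fin n → Set V, IsNPartition n A ∧ r = edgeRatioMax G A}

/-- The `n`-way symmetric vertex isoperimetric constant `ι_n(Γ)`. -/
noncomputable def multiIota (G : SimpleGraph V) (n : ℕ) : ℝ :=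
  sInf {r | ∃ A : Fin n → Set V, IsNPartition n A ∧ r = vertRatioMax G A}

/-- A graph is vertex-transitive if its automorphism group acts transitively on vertices. -/
def VertexTransitive (G : SimpleGraph V) : Prop :=
  ∀ u v : V, ∃ φ : G ≃g G, φ u = v


/-- The eigenvalues of the (nonnormalized) combinatorial Laplacian of `G`,
sorted in nondecreasing order, indexed so that position `0` holds `λ_1 = 0`. -/
noncomputable def lapEigenSorted {V : Type*} [Fintype V] [DecidableEq V]
    (G : SimpleGraph V) [DecidableRel G.Adj] : Fin (Fintype.card V) → ℝ :=
  (SimpleGraph.posSemidef_lapMatrix ℝ G).isHermitian.eigenvalues₀ ∘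
    Tuple.sort (SimpleGraph.posSemidef_lapMatrix ℝ G).isHermitian.eigenvalues₀

open MeasureTheory in
theorem group_aux {α : Type*} [DecidableEq α] (w : α → ℝ) (b : ℝ) (hb : 1 ≤ b)
    (hwb : ∀ z, w z ≤ b) (n : ℕ) : ∀ S : Finset α, n * b + 1/2 ≤ ∑ z ∈ S, w z →
    ∃ T : ℕ → Finset α, (∀ i ≤ n, T i ⊆ S ∧ 1/2 ≤ ∑ z ∈ T i, w z) ∧
      ∀ i ≤ n, ∀ j ≤ n, i ≠ j → Disjoint (T i) (T j) := by
  induction n with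
  | zero =>
    intro S hS
    refine ⟨fun _ => S, ?_, ?_⟩
    · intro i _; exact ⟨subset_rfl, by simpa using hS⟩
    · intro i hi j hj hij; omega
  | succ n ih =>
    intro S hS
    have hS2 : 1/2 ≤ ∑ z ∈ S, w z := by
      refine le_trans ?_ hS; have : 0 ≤ ((n+1:ℕ):ℝ) * b := by positivity
      linarith
    obtain ⟨T0, hT0, hmin⟩ := (S.powerset.filter (fun T => 1/2 ≤ ∑ z ∈ T, w z)).exists_min_image
      Finset.card ⟨S, by simpa using hS2⟩
    simp only [Finset.mem_filter, Finset.mem_powerset] at hT0 hmin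
    have hle : ∑ z ∈ T0, w z ≤ b := by
      by_cases h : ∃ e ∈ T0, w e < 1/2
      · obtain ⟨e, he, hwe⟩ := h
        have h1 : ∑ z ∈ T0.erase e, w z < 1/2 := by
          by_contra! hc
          have := hmin (T0.erase e) ⟨(Finset.erase_subset _ _).trans hT0.1, hc⟩
          have := Finset.card_erase_lt_of_mem he
          omega
        have := Finset.add_sum_erase T0 w he
        linarith
      · push Not at h
        have hne : T0.Nonempty := by
          by_contra hc
          rw [Finset.not_nonempty_iff_eq_empty] at hc
          have := hT0.2
          rw [hc] at this; norm_num at this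
        obtain ⟨e, he⟩ := hne
        have := hmin {e} ⟨by simpa using hT0.1 he, by simpa using h e he⟩
        rw [Finset.card_singleton] at this
        have h2 : T0 = {e} := by
          symm; apply Finset.eq_of_subset_of_card_le (by simpa using he) (by simpa using this)
        rw [h2]; simpa using hwb e
    have hsd := Finset.sum_sdiff (f := w) hT0.1
    obtain ⟨T, hT1, hT2⟩ := ih (S \ T0) (by push_cast at hS; linarith)
    refine ⟨fun i => if i = n + 1 then T0 else T i, ?_, ?_⟩
    · intro i hi
      by_cases h : i = n+1
      · simp only [h, if_true]; exact hT0
      · simp only [h, if_false]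
        exact ⟨(hT1 i (by omega)).1.trans Finset.sdiff_subset, (hT1 i (by omega)).2⟩
    · intro i hi j hj hij
      have key : ∀ i ≤ n, Disjoint (T i) T0 := fun i hi =>
        Finset.disjoint_of_subset_left (hT1 i hi).1 Finset.sdiff_disjoint
      by_cases h : i = n+1 <;> by_cases h' : j = n+1
      · omega
      · simp only [h, h', if_true, if_false]; exact (key j (by omega)).symm
      · simp only [h, h', if_true, if_false]; exact (key i (by omega))
      · simp only [h, h', if_false]; exact hT2 i (by omega) j (by omega) hij

open MeasureTheory in
theorem shift_meas (y ρ : ℝ) :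
    volume ({a : ℝ | ∃ j : ℤ, a + j ∈ Set.Icc (y - ρ) (y + ρ)} ∩ Set.Ioc 0 1)
      ≤ ENNReal.ofReal (2 * ρ) := by
  have h1 : ({a : ℝ | ∃ j : ℤ, a + j ∈ Set.Icc (y - ρ) (y + ρ)} ∩ Set.Ioc 0 1)
      = ⋃ j : ℤ, (fun a : ℝ => a + j) ⁻¹' (Set.Icc (y - ρ) (y + ρ) ∩ Set.Ioc (j:ℝ) (j+1)) := by
    ext a
    simp only [Set.mem_inter_iff, Set.mem_ofPred_eq, Set.mem_iUnion, Set.mem_preimage, Set.mem_Ioc]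
    constructor
    · rintro ⟨⟨j, hj⟩, h0, h1⟩
      exact ⟨j, hj, by linarith, by linarith⟩
    · rintro ⟨j, hj, h0, h1⟩
      exact ⟨⟨j, hj⟩, by linarith, by linarith⟩
  rw [h1]
  refine (measure_iUnion_le _).trans ?_
  simp_rw [measure_preimage_add_right]
  rw [← measure_iUnion]
  · rw [← Set.inter_iUnion, iUnion_Ioc_intCast, Set.inter_univ, Real.volume_Icc]
    apply ENNReal.ofReal_le_ofReal; linarith
  · intro i j hij
    exact (Set.pairwise_disjoint_Ioc_intCast ℝ hij).mono Set.inter_subset_right Set.inter_subset_right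
  · intro j; measurability

open MeasureTheory in
theorem avg_aux {ι : Type*} [Fintype ι] (s : Set ℝ) (h0 : volume s ≠ 0)
    (h1 : volume s ≠ ⊤)
    (c : ι → ℝ) (S : ι → Set ℝ) (hS : ∀ i, MeasurableSet (S i))
    (hle : ∑ i, c i * (volume (S i ∩ s)).toReal ≤ 0) :
    ∃ t ∈ s, ∑ i, c i * (S i).indicator 1 t ≤ 0 := by
  have hint : ∀ i, IntegrableOn (fun t => c i * (S i).indicator (1 : ℝ → ℝ) t) s := by
    intro i
    apply Integrable.const_mul
    have : IsFiniteMeasure (volume.restrict s) := ⟨by simpa using h1.lt_top⟩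
    exact (integrable_const (1:ℝ)).indicator (hS i)
  obtain ⟨t, ht, hle2⟩ := exists_le_setAverage (μ := volume) (s := s)
    (f := fun t => ∑ i, c i * (S i).indicator (1 : ℝ → ℝ) t) h0 h1
    (integrable_finsetSum _ (fun i _ => hint i))
  refine ⟨t, ht, hle2.trans ?_⟩
  rw [setAverage_eq, integral_finsetSum _ (fun i _ => hint i)]
  have : ∀ i, ∫ t in s, c i * (S i).indicator (1 : ℝ → ℝ) t = c i * (volume (S i ∩ s)).toReal := by
    intro i
    rw [integral_const_mul, integral_indicator_one (hS i), measureReal_def,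
      Measure.restrict_apply (hS i)]
  simp_rw [this]
  rw [smul_eq_mul]
  exact mul_nonpos_of_nonneg_of_nonpos (by positivity) hle

theorem coarea_aux {V : Type*} [Fintype V] (G : SimpleGraph V) (h β : V → ℝ)
    (h0 : ∀ v, 0 ≤ h v) (hM : 1/2 ≤ ∑ v, h v)
    (hβ : ∀ v u, G.Adj v u → |h u - h v| ≤ β v) (hβ0 : ∀ v, 0 ≤ β v) :
    ∃ t : ℝ, 0 ≤ t ∧ {v | t < h v}.Nonempty ∧
      ((vertBdry G {v | t < h v}).ncard : ℝ) ≤ (4 * ∑ v, β v) * ({v | t < h v}.ncard : ℝ) := by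
  classical
  have hne : (Finset.univ : Finset V).Nonempty := by
    by_contra hc
    rw [Finset.not_nonempty_iff_eq_empty] at hc
    rw [hc] at hM; norm_num at hM
  obtain ⟨p, -, hp⟩ := Finset.univ.exists_max_image h hne
  have hpos : 0 < h p := by
    by_contra! hc
    have : ∑ v, h v ≤ 0 := Finset.sum_nonpos fun v hv => (hp v hv).trans hc
    linarith
  set B := ∑ v, β v with hB
  have hB0 : 0 ≤ B := Finset.sum_nonneg fun v _ => hβ0 v
  obtain ⟨t, ht, hle⟩ := avg_aux (ι := V ⊕ V) (Set.Ico 0 (h p))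
    (by simp [hpos]) (by simp)
    (Sum.elim (fun _ => 1) (fun _ => -(4 * B)))
    (Sum.elim (fun v => Set.Ico (h v - β v) (h v + β v)) (fun v => Set.Iio (h v)))
    (by rintro (v | v) <;> simp) (by
      rw [Fintype.sum_sum_type]
      simp only [Sum.elim_inl, Sum.elim_inr]
      have e1 : ∀ v, (MeasureTheory.volume (Set.Ico (h v - β v) (h v + β v) ∩ Set.Ico 0 (h p))).toReal
          ≤ 2 * β v := by
        intro v
        refine (ENNReal.toReal_mono (by simp) (MeasureTheory.measure_mono Set.inter_subset_left)).trans ?_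
        rw [Real.volume_Ico, ENNReal.toReal_ofReal (by linarith [hβ0 v])]; linarith
      have e2 : ∀ v, (MeasureTheory.volume (Set.Iio (h v) ∩ Set.Ico 0 (h p))).toReal = h v := by
        intro v
        have : Set.Iio (h v) ∩ Set.Ico 0 (h p) = Set.Ico 0 (h v) := by
          ext a
          simp only [Set.mem_inter_iff, Set.mem_Iio, Set.mem_Ico]
          have := hp v (Finset.mem_univ v)
          constructor
          · rintro ⟨h1, h2, h3⟩; exact ⟨h2, h1⟩
          · rintro ⟨h1, h2⟩; exact ⟨h2, h1, by linarith⟩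
        rw [this, Real.volume_Ico, ENNReal.toReal_ofReal (by linarith [h0 v])]; ring
      simp_rw [e2, one_mul]
      rw [← Finset.mul_sum]
      have := Finset.sum_le_sum (fun v (_ : v ∈ Finset.univ) => e1 v)
      rw [← Finset.mul_sum, ← hB] at this
      nlinarith)
  rw [Fintype.sum_sum_type] at hle
  simp only [Sum.elim_inl, Sum.elim_inr, one_mul] at hle
  rw [← Finset.mul_sum] at hle
  refine ⟨t, ht.1, ⟨p, ht.2⟩, ?_⟩
  have c2 : ({v | t < h v}.ncard : ℝ) = ∑ v, (Set.Iio (h v)).indicator (1 : ℝ → ℝ) t := by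
    rw [Set.ncard_eq_toFinset_card']
    simp [Set.indicator_apply]
  have c1 : ((vertBdry G {v | t < h v}).ncard : ℝ)
      ≤ ∑ v, (Set.Ico (h v - β v) (h v + β v)).indicator (1 : ℝ → ℝ) t := by
    calc ((vertBdry G {v | t < h v}).ncard : ℝ)
        ≤ ({v | t ∈ Set.Ico (h v - β v) (h v + β v)}.ncard : ℝ) := by
          norm_cast
          apply Set.ncard_le_ncard _ (Set.toFinite _)
          rintro v ⟨u, hu, hx⟩
          have := abs_le.1 (hβ v u hu)
          simp only [Set.mem_ofPred_eq] at hx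
          simp only [Set.mem_ofPred_eq, Set.mem_Ico]
          by_cases h1 : t < h v
          · have h2 : ¬ t < h u := fun h2 => hx ⟨fun _ => h2, fun _ => h1⟩
            constructor <;> linarith [hβ0 v]
          · have h2 : t < h u := by
              by_contra h2
              exact hx ⟨fun h => absurd h h1, fun h => absurd h h2⟩
            constructor <;> linarith [hβ0 v]
      _ = _ := by
          rw [Set.ncard_eq_toFinset_card']
          simp [Set.indicator_apply]
  rw [c2]
  linarith

theorem iota_le {V : Type*} [Fintype V] (G : SimpleGraph V) (n : ℕ) (hn : 0 < n) (r : ℝ)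
    (hr : 0 ≤ r) (A : Fin n → Set V) (hne : ∀ i, (A i).Nonempty)
    (hd : ∀ i j, i ≠ j → Disjoint (A i) (A j))
    (hb : ∀ i, ((vertBdry G (A i)).ncard : ℝ) ≤ r * ((A i).ncard : ℝ)) :
    multiIota G n ≤ n * r := by
  classical
  have : NeZero n := ⟨by omega⟩
  obtain ⟨p, -, hp⟩ := Finset.univ.exists_max_image (fun i => (A i).ncard)
    (Finset.univ_nonempty (α := Fin n))
  let P : Fin n → Set V := fun i => if i = p then (⋃ j ∈ {j | j ≠ p}, A j)ᶜ else A i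
  have hPp : P p = (⋃ j ∈ {j | j ≠ p}, A j)ᶜ := by simp [P]
  have hPi : ∀ i, i ≠ p → P i = A i := fun i hi => by simp [P, hi]
  have hsub : A p ⊆ P p := by
    rw [hPp]
    intro v hv
    simp only [Set.mem_compl_iff, Set.mem_iUnion, not_exists]
    intro j hj hvj
    exact Set.disjoint_left.1 (hd j p hj) hvj hv
  have hpart : IsNPartition n P := by
    refine ⟨?_, ?_, ?_⟩
    · intro i
      by_cases h : i = p
      · subst h; exact (hne i).mono hsub
      · rw [hPi i h]; exact hne i
    · have key : ∀ j, j ≠ p → Disjoint (P p) (A j) := by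
        intro j hj
        rw [hPp, Set.disjoint_compl_left_iff_subset]
        exact Set.subset_biUnion_of_mem (u := A) (show j ∈ {j | j ≠ p} from hj)
      intro i j hij
      by_cases h : i = p <;> by_cases h' : j = p
      · exact absurd (h.trans h'.symm) hij
      · rw [h, hPi j h']; exact key j h'
      · rw [h', hPi i h]; exact (key i h).symm
      · rw [hPi i h, hPi j h']; exact hd i j hij
    · rw [Set.eq_univ_iff_forall]
      intro v
      by_cases hv : v ∈ P p
      · exact Set.mem_iUnion.2 ⟨p, hv⟩
      · rw [hPp, Set.mem_compl_iff, not_not] at hv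
        simp only [Set.mem_iUnion] at hv
        obtain ⟨j, hj, hvj⟩ := hv
        exact Set.mem_iUnion.2 ⟨j, by rw [hPi j hj]; exact hvj⟩
  have hratio : vertRatioMax G P ≤ n * r := by
    apply ciSup_le
    intro i
    have hn1 : (1 : ℝ) ≤ n := by exact_mod_cast hn
    have hposi : (0 : ℝ) < ((P i).ncard : ℝ) := by
      exact_mod_cast (Set.ncard_pos (Set.toFinite _)).2 (hpart.1 i)
    rw [div_le_iff₀ hposi]
    by_cases h : i = p
    · subst h
      have hbs : vertBdry G (P i) ⊆ ⋃ j ∈ (Finset.univ : Finset (Fin n)), vertBdry G (A j) := by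
        rintro v ⟨u, hu, hx⟩
        rw [hPp] at hx
        simp only [Set.mem_compl_iff, not_iff_not] at hx
        by_contra hc
        apply hx
        simp only [Set.mem_iUnion, not_exists, Finset.mem_univ, exists_prop, true_and] at hc ⊢
        refine exists_congr fun j => and_congr_right fun _ => ?_
        by_contra hc2
        exact hc j ⟨u, hu, hc2⟩
      have h1 : (vertBdry G (P i)).ncard ≤ ∑ j, (vertBdry G (A j)).ncard :=
        (Set.ncard_le_ncard hbs (Set.toFinite _)).trans (Finset.set_ncard_biUnion_le _ _)
      have h2 : ((vertBdry G (P i)).ncard : ℝ) ≤ ∑ j, ((vertBdry G (A j)).ncard : ℝ) := by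
        exact_mod_cast h1
      have h3 : ∀ j, ((vertBdry G (A j)).ncard : ℝ) ≤ r * ((P i).ncard : ℝ) := by
        intro j
        refine (hb j).trans (mul_le_mul_of_nonneg_left ?_ hr)
        exact_mod_cast (hp j (Finset.mem_univ j)).trans (Set.ncard_le_ncard hsub (Set.toFinite _))
      refine h2.trans ((Finset.sum_le_sum fun j _ => h3 j).trans ?_)
      simp [mul_assoc]
    · rw [hPi i h]
      refine (hb i).trans ?_
      gcongr
      nlinarith
  have hmem : vertRatioMax G P ∈
      {r | ∃ A : Fin n → Set V, IsNPartition n A ∧ r = vertRatioMax G A} := ⟨P, hpart, rfl⟩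
  refine (csInf_le ?_ hmem).trans hratio
  refine ⟨0, ?_⟩
  rintro x ⟨Q, -, rfl⟩
  exact Real.iSup_nonneg fun i => by positivity

theorem radial_aux {E : Type*} [NormedAddCommGroup E] [InnerProductSpace ℝ E] (a b : E) :
    ‖(‖a‖⁻¹ • a) - (‖b‖⁻¹ • b)‖ * ‖b‖ ≤ 2 * ‖a - b‖ := by
  by_cases hb : b = 0
  · simp [hb]
  by_cases ha : a = 0
  · have : ‖b‖ ≠ 0 := by simpa using hb
    simp [ha, norm_smul, this]
    linarith [norm_nonneg b]
  have ha' : ‖a‖ ≠ 0 := by simpa using ha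
  have hb' : ‖b‖ ≠ 0 := by simpa using hb
  have h1 : ‖(‖a‖⁻¹ • a) - (‖b‖⁻¹ • b)‖ * ‖b‖ = ‖((‖b‖ - ‖a‖) * ‖a‖⁻¹) • a + (a - b)‖ := by
    rw [mul_comm, ← norm_norm b, ← norm_smul, norm_norm]
    congr 1
    rw [smul_sub, smul_smul, smul_smul, mul_inv_cancel₀ hb', sub_mul, mul_inv_cancel₀ ha', sub_smul]
    simp
  rw [h1]
  refine (norm_add_le _ _).trans ?_
  have h2 : ‖((‖b‖ - ‖a‖) * ‖a‖⁻¹) • a‖ ≤ ‖a - b‖ := by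
    rw [norm_smul, norm_mul, norm_inv, norm_norm, mul_assoc, inv_mul_cancel₀ ha', mul_one,
      norm_sub_rev a b]
    exact abs_norm_sub_norm_le _ _
  linarith

theorem cell_mass {V : Type*} [Fintype V] (n : ℕ) (hn : 2 ≤ n)
    (F : V → EuclideanSpace ℝ (Fin n))
    (hiso : ∀ y, ∑ v, (inner ℝ (F v) y) ^ 2 = ‖y‖ ^ 2) (Z : Finset V)
    (hZ : ∀ u ∈ Z, ∀ v ∈ Z, ‖(‖F u‖⁻¹ • F u) - (‖F v‖⁻¹ • F v)‖ ^ 2 ≤ 1 / (9 * n)) :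
    ∑ v ∈ Z, ‖F v‖ ^ 2 ≤ 1 + 1 / (4 * n) := by
  have hn0 : (2 : ℝ) ≤ n := by exact_mod_cast hn
  by_cases hall : ∀ v ∈ Z, F v = 0
  · rw [Finset.sum_eq_zero (fun v hv => by simp [hall v hv])]
    positivity
  push Not at hall
  obtain ⟨u, hu, hFu⟩ := hall
  have hnu : ‖F u‖ ≠ 0 := by simpa using hFu
  set q : ℝ := 1 / (9 * n) with hq
  have hq0 : 0 < q := by positivity
  have hq1 : q * n = 1 / 9 := by rw [hq]; field_simp
  have hq2 : q ≤ 1 / 18 := by nlinarith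
  have hxu : ‖‖F u‖⁻¹ • F u‖ = 1 := by rw [norm_smul, norm_inv, norm_norm, inv_mul_cancel₀ hnu]
  have h1 : ∀ v ∈ Z, ‖F v‖ ^ 2 * (1 - q) ≤ (inner ℝ (F v) (‖F u‖⁻¹ • F u)) ^ 2 := by
    intro v hv
    by_cases hFv : F v = 0
    · simp [hFv]
    have hnv : ‖F v‖ ≠ 0 := by simpa using hFv
    have hxv : ‖‖F v‖⁻¹ • F v‖ = 1 := by rw [norm_smul, norm_inv, norm_norm, inv_mul_cancel₀ hnv]
    have h2 := hZ v hv u hu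
    rw [norm_sub_sq_real, hxu, hxv] at h2
    set c := inner ℝ (‖F v‖⁻¹ • F v) (‖F u‖⁻¹ • F u) with hc
    have h3 : inner ℝ (F v) (‖F u‖⁻¹ • F u) = ‖F v‖ * c := by
      rw [hc, real_inner_smul_left, ← mul_assoc, mul_inv_cancel₀ hnv, one_mul]
    rw [h3, mul_pow]
    apply mul_le_mul_of_nonneg_left _ (by positivity)
    nlinarith
  have h4 : (∑ v ∈ Z, ‖F v‖ ^ 2) * (1 - q) ≤ 1 := by
    rw [Finset.sum_mul]
    refine (Finset.sum_le_sum h1).trans ?_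
    have := hiso (‖F u‖⁻¹ • F u)
    rw [hxu, one_pow] at this
    rw [← this]
    exact Finset.sum_le_sum_of_subset_of_nonneg (Finset.subset_univ _) (fun _ _ _ => sq_nonneg _)
  have h5 : (1 : ℝ) / (4 * n) = 9 / 4 * q := by rw [hq]; field_simp
  rw [h5]
  by_contra! hcon
  have : (1 + 9 / 4 * q) * (1 - q) < 1 :=
    lt_of_lt_of_le (mul_lt_mul_of_pos_right hcon (by linarith)) h4
  nlinarith

theorem shift_exists {V : Type*} [Fintype V] (m ρ y : V → ℝ) (hm : ∀ v, 0 ≤ m v)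
    (hρ : ∀ v, 0 ≤ ρ v) :
    ∃ a : ℝ, ∑ v, m v * ({a : ℝ | ∃ j : ℤ, a + j ∈ Set.Icc (y v - ρ v) (y v + ρ v)}).indicator
      (1 : ℝ → ℝ) a ≤ ∑ v, m v * (2 * ρ v) := by
  obtain ⟨t, ht, hle⟩ := avg_aux (ι := V ⊕ V) (Set.Ioc 0 1) (by simp) (by simp)
    (Sum.elim m (fun v => -(m v * (2 * ρ v))))
    (Sum.elim (fun v => {a : ℝ | ∃ j : ℤ, a + j ∈ Set.Icc (y v - ρ v) (y v + ρ v)})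
      (fun _ => Set.univ))
    (by
      rintro (v | v)
      · simp only [Sum.elim_inl]
        have : {a : ℝ | ∃ j : ℤ, a + j ∈ Set.Icc (y v - ρ v) (y v + ρ v)}
          = ⋃ j : ℤ, (fun a : ℝ => a + j) ⁻¹' Set.Icc (y v - ρ v) (y v + ρ v) := by
          ext a; simp only [Set.mem_iUnion, Set.mem_preimage, Set.mem_ofPred_eq]
        rw [this]
        exact MeasurableSet.iUnion fun j => (measurable_add_const _) measurableSet_Icc
      · simp) (by
      rw [Fintype.sum_sum_type]
      simp only [Sum.elim_inl, Sum.elim_inr, Set.univ_inter, Real.volume_Ioc, sub_zero,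
        ENNReal.ofReal_one, ENNReal.toReal_one, mul_one, Finset.sum_neg_distrib]
      rw [← sub_eq_add_neg, sub_nonpos]
      refine Finset.sum_le_sum fun v _ => mul_le_mul_of_nonneg_left ?_ (hm v)
      refine (ENNReal.toReal_mono ENNReal.ofReal_ne_top (shift_meas _ _)).trans ?_
      rw [ENNReal.toReal_ofReal (by linarith [hρ v])])
  refine ⟨t, ?_⟩
  rw [Fintype.sum_sum_type] at hle
  simp only [Sum.elim_inl, Sum.elim_inr, Set.indicator_univ, Pi.one_apply, mul_one,
    Finset.sum_neg_distrib] at hle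
  linarith

theorem floor_aux (a y z ρ : ℝ) (hyz : |z - y| ≤ ρ)
    (h : ¬ ∃ j : ℤ, a + j ∈ Set.Icc (y - ρ) (y + ρ)) : ⌊z - a⌋ = ⌊y - a⌋ := by
  by_contra hne
  have hab := abs_le.1 hyz
  rcases lt_or_gt_of_ne hne with hlt | hlt
  · apply h
    refine ⟨⌊y - a⌋, ?_⟩
    have h1 := Int.floor_le (y - a)
    have h2 := Int.floor_lt.1 hlt
    constructor <;> linarith
  · apply h
    refine ⟨⌊z - a⌋, ?_⟩
    have h1 := Int.floor_le (z - a)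
    have h2 := Int.floor_lt.1 hlt
    constructor <;> linarith

set_option maxHeartbeats 1000000 in
theorem core {V : Type*} [Fintype V] (G : SimpleGraph V) [DecidableRel G.Adj]
    (n : ℕ) (hn : 2 ≤ n) (F : V → EuclideanSpace ℝ (Fin n))
    (hiso : ∀ y, ∑ v, (inner ℝ (F v) y) ^ 2 = ‖y‖ ^ 2) (htr : ∑ v, ‖F v‖ ^ 2 = n)
    (lam : ℝ) (hlam : 0 ≤ lam)
    (hE : ∑ v, ∑ u, (if G.Adj v u then ‖F u - F v‖ ^ 2 else 0) ≤ 2 * n * lam) :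
    multiIota G n ≤ n * (24 * (n ^ 3 * √lam) ^ 2 + 156 * (n ^ 3 * √lam)) := by
  classical
  have hn0 : (2 : ℝ) ≤ n := by exact_mod_cast hn
  set D : V → ℝ := fun v => √(∑ u, (if G.Adj v u then ‖F u - F v‖ ^ 2 else 0)) with hD
  have hsn : ∀ v, 0 ≤ ∑ u, (if G.Adj v u then ‖F u - F v‖ ^ 2 else 0) :=
    fun v => Finset.sum_nonneg fun u _ => by split_ifs <;> positivity
  have hD0 : ∀ v, 0 ≤ D v := fun v => Real.sqrt_nonneg _
  have hDsq : ∀ v, D v ^ 2 = ∑ u, (if G.Adj v u then ‖F u - F v‖ ^ 2 else 0) :=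
    fun v => Real.sq_sqrt (hsn v)
  have hDadj : ∀ v u, G.Adj v u → ‖F u - F v‖ ≤ D v := by
    intro v u huv
    apply Real.le_sqrt_of_sq_le
    refine le_trans ?_ (Finset.single_le_sum (f := fun u => if G.Adj v u then ‖F u - F v‖ ^ 2 else 0)
      (fun u _ => by split_ifs <;> positivity) (Finset.mem_univ u))
    simp [huv]
  have hDsum : ∑ v, D v ^ 2 ≤ 2 * n * lam := by simp_rw [hDsq]; exact hE
  -- Cauchy-Schwarz
  have hCS : ∑ v, D v * ‖F v‖ ≤ 3 / 2 * n * √lam := by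
    have h1 := Finset.sum_mul_sq_le_sq_mul_sq Finset.univ D (fun v => ‖F v‖)
    rw [htr] at h1
    apply abs_le_of_sq_le_sq' _ (by positivity) |>.2
    have h2 : √lam ^ 2 = lam := Real.sq_sqrt hlam
    calc _ ≤ _ := h1
      _ ≤ 2 * n * lam * n := by gcongr
      _ ≤ (3 / 2 * n * √lam) ^ 2 := by
        rw [mul_pow, mul_pow, h2]; nlinarith [mul_nonneg (sq_nonneg (n:ℝ)) hlam]
  set x : V → EuclideanSpace ℝ (Fin n) := fun v => ‖F v‖⁻¹ • F v with hx
  set ρ : V → ℝ := fun v => 3 * n * (2 * D v / ‖F v‖) with hρ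
  have hρ0 : ∀ v, 0 ≤ ρ v := fun v => by have := hD0 v; positivity
  choose a ha using fun k : Fin n => shift_exists (fun v => ‖F v‖ ^ 2) ρ
    (fun v => 3 * n * x v k) (fun v => by positivity) hρ0
  let bad : V → Prop := fun v => ∃ k, ∃ j : ℤ,
    a k + j ∈ Set.Icc (3 * n * x v k - ρ v) (3 * n * x v k + ρ v)
  have hbad : ∑ v, (if bad v then ‖F v‖ ^ 2 else 0) ≤ 18 * n ^ 3 * √lam := by
    have h1 : ∀ v, (if bad v then ‖F v‖ ^ 2 else 0) ≤ ∑ k : Fin n, ‖F v‖ ^ 2 *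
        ({a : ℝ | ∃ j : ℤ, a + j ∈ Set.Icc (3 * n * x v k - ρ v) (3 * n * x v k + ρ v)}).indicator
        (1 : ℝ → ℝ) (a k) := by
      intro v
      have hnn : ∀ k ∈ (Finset.univ : Finset (Fin n)), 0 ≤ ‖F v‖ ^ 2 *
        ({a : ℝ | ∃ j : ℤ, a + j ∈ Set.Icc (3 * n * x v k - ρ v) (3 * n * x v k + ρ v)}).indicator
        (1 : ℝ → ℝ) (a k) := fun k _ =>
          mul_nonneg (by positivity) (Set.indicator_nonneg (fun _ _ => by simp) _)
      split_ifs with hb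
      · obtain ⟨k, hk⟩ := hb
        refine le_trans ?_ (Finset.single_le_sum hnn (Finset.mem_univ k))
        rw [Set.indicator_of_mem (by exact hk)]; simp
      · exact Finset.sum_nonneg hnn
    refine (Finset.sum_le_sum fun v _ => h1 v).trans ?_
    rw [Finset.sum_comm]
    refine (Finset.sum_le_sum fun k _ => ha k).trans ?_
    have h2 : ∀ v, ‖F v‖ ^ 2 * (2 * ρ v) = 12 * n * (D v * ‖F v‖) := by
      intro v
      by_cases hF : ‖F v‖ = 0
      · simp [hF]
      · simp only [hρ]; field_simp; ring
    simp_rw [h2]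
    rw [← Finset.mul_sum, Finset.sum_const, Finset.card_univ, Fintype.card_fin, nsmul_eq_mul]
    calc (n : ℝ) * (12 * n * ∑ v, D v * ‖F v‖) ≤ n * (12 * n * (3 / 2 * n * √lam)) := by gcongr
      _ = _ := by ring
  -- cells
  let c : V → (Fin n → ℤ) := fun v k => ⌊3 * n * x v k - a k⌋
  let w : (Fin n → ℤ) → ℝ := fun z => ∑ v with c v = z, ‖F v‖ ^ 2
  have hw : ∀ z, w z ≤ 1 + 1 / (4 * n) := by
    intro z
    apply cell_mass n hn F hiso
    intro u hu v hv
    simp only [Finset.mem_filter, Finset.mem_univ, true_and] at hu hv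
    rw [EuclideanSpace.norm_sq_eq]
    have h1 : ∀ k : Fin n, ‖(x u - x v) k‖ ^ 2 ≤ 1 / (9 * n ^ 2) := by
      intro k
      have h2 : ⌊3 * n * x u k - a k⌋ = ⌊3 * n * x v k - a k⌋ := congrFun (hu.trans hv.symm) k
      have h3 := Int.abs_sub_lt_one_of_floor_eq_floor h2
      have h4 : 3 * n * x u k - a k - (3 * n * x v k - a k) = 3 * n * ((x u - x v) k) := by
        rw [PiLp.sub_apply]; ring
      rw [h4] at h3
      have h5 : (3 * n * ((x u - x v) k)) ^ 2 ≤ 1 := by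
        rw [sq_le_one_iff_abs_le_one]; exact h3.le
      rw [Real.norm_eq_abs, sq_abs, le_div_iff₀ (by positivity)]
      linarith [h5]
    refine (Finset.sum_le_sum fun k _ => h1 k).trans ?_
    rw [Finset.sum_const, Finset.card_univ, Fintype.card_fin, nsmul_eq_mul]
    apply le_of_eq; field_simp
  have htot : ∑ z ∈ Finset.univ.image c, w z = n := by
    rw [← htr]
    exact Finset.sum_fiberwise_of_maps_to (fun v _ => Finset.mem_image_of_mem c (Finset.mem_univ v)) _
  obtain ⟨T, hT1, hT2⟩ := group_aux w (1 + 1 / (4 * n)) (by have : (0:ℝ) ≤ 1 / (4 * n) := by positivity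
                                                            linarith) hw (n - 1)
    (Finset.univ.image c) (by
      rw [htot, Nat.cast_sub (by omega)]
      have : (1 : ℝ) / (4 * n) * n = 1 / 4 := by field_simp
      have : (0:ℝ) ≤ 1 / (4 * n) := by positivity
      push_cast
      nlinarith)
  let h : Fin n → V → ℝ := fun i v => if c v ∈ T i then ‖F v‖ ^ 2 else 0
  let β : V → ℝ := fun v => 3 * D v ^ 2 + 2 * (D v * ‖F v‖) + 2 * (if bad v then ‖F v‖ ^ 2 else 0)
  have hbad0 : ∀ v, 0 ≤ (if bad v then ‖F v‖ ^ 2 else 0) := fun v => by split_ifs <;> positivity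
  have hβ0 : ∀ v, 0 ≤ β v := fun v => by
    have := hD0 v; have := hbad0 v; simp only [β]; positivity
  have hh0 : ∀ i v, 0 ≤ h i v := fun i v => by simp only [h]; split_ifs <;> positivity
  have hhm : ∀ i v, h i v ≤ ‖F v‖ ^ 2 := fun i v => by
    simp only [h]; split_ifs
    · exact le_rfl
    · positivity
  have hM : ∀ i, 1 / 2 ≤ ∑ v, h i v := by
    intro i
    refine (hT1 i (by omega)).2.trans (le_of_eq ?_)
    simp only [w, h]
    rw [← Finset.sum_filter]
    rw [← Finset.sum_fiberwise_of_maps_to (s := Finset.univ.filter fun v => c v ∈ T i) (t := T i)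
      (g := c) (fun v hv => (Finset.mem_filter.1 hv).2)]
    refine Finset.sum_congr rfl fun z hz => Finset.sum_congr ?_ fun _ _ => rfl
    ext v
    simp only [Finset.mem_filter, Finset.mem_univ, true_and]
    constructor
    · intro hv; exact ⟨hv ▸ hz, hv⟩
    · intro hv; exact hv.2
  have hβ : ∀ i v u, G.Adj v u → |h i u - h i v| ≤ β v := by
    intro i v u huv
    have hd := hDadj v u huv
    have hDv := hD0 v
    have hFu : ‖F u‖ ≤ ‖F v‖ + D v := by
      have := norm_le_norm_add_norm_sub' (F u) (F v)
      linarith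
    have hFv : ‖F v‖ ≤ ‖F u‖ + D v := by
      have := norm_le_norm_add_norm_sub' (F v) (F u)
      rw [norm_sub_rev] at this
      linarith
    have nu := norm_nonneg (F u)
    have nv := norm_nonneg (F v)
    have hu2 : ‖F u‖ ^ 2 ≤ ‖F v‖ ^ 2 + 2 * (D v * ‖F v‖) + D v ^ 2 := by nlinarith
    have hb0 := hbad0 v
    have hhu := hhm i u
    have hhv := hhm i v
    have hu0 := hh0 i u
    have hv0 := hh0 i v
    have hDF : 0 ≤ D v * ‖F v‖ := mul_nonneg hDv nv
    have hDD : 0 ≤ D v ^ 2 := sq_nonneg _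
    have hFF : 0 ≤ ‖F v‖ ^ 2 := sq_nonneg _
    have hv2 : ‖F v‖ ^ 2 ≤ ‖F u‖ ^ 2 + 2 * (D v * ‖F v‖) + D v ^ 2 := by
      rcases le_total (D v) ‖F v‖ with h1 | h1
      · nlinarith
      · nlinarith [sq_nonneg (‖F u‖)]
    by_cases hF : ‖F v‖ = 0
    · rw [hF] at hhv hu2
      simp only [β]
      simp only [mul_zero, ne_eq, OfNat.ofNat_ne_zero, not_false_eq_true, zero_pow] at hhv hu2
      rw [abs_le]; constructor <;> linarith
    by_cases hb : bad v
    · simp only [β, if_pos hb]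
      rw [abs_le]; constructor <;> linarith
    · have hc : c u = c v := by
        funext k
        apply floor_aux _ _ _ (ρ v)
        · have h1 := radial_aux (F u) (F v)
          have h2 : |(x u - x v) k| ≤ ‖x u - x v‖ := by
            rw [← Real.norm_eq_abs]; exact PiLp.norm_apply_le _ _
          rw [PiLp.sub_apply] at h2
          have hFp : 0 < ‖F v‖ := lt_of_le_of_ne nv (Ne.symm hF)
          have h3 : ‖x u - x v‖ ≤ 2 * D v / ‖F v‖ := by
            rw [le_div_iff₀ hFp]; linarith
          rw [← mul_sub, abs_mul, abs_of_nonneg (by positivity : (0:ℝ) ≤ 3 * n)]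
          simp only [hρ]
          gcongr
          linarith
        · exact fun hj => hb ⟨k, hj⟩
      have hc' : h i u = if c v ∈ T i then ‖F u‖ ^ 2 else 0 := by simp only [h, hc]
      rw [hc']
      simp only [h, β, if_neg hb]
      split_ifs
      · rw [abs_le]; constructor <;> linarith
      · rw [sub_zero, abs_zero]; linarith
  choose t ht0 htne htb using fun i => coarea_aux G (h i) β (hh0 i) (hM i) (hβ i) hβ0
  have hr : 4 * ∑ v, β v ≤ 24 * (n ^ 3 * √lam) ^ 2 + 156 * (n ^ 3 * √lam) := by
    simp only [β, Finset.sum_add_distrib, ← Finset.mul_sum]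
    have hl : (n ^ 3 * √lam) ^ 2 = (n:ℝ) ^ 6 * lam := by
      rw [mul_pow, Real.sq_sqrt hlam]; ring
    have h1 : (n:ℝ) ≤ n ^ 6 := le_self_pow₀ (by linarith) (by norm_num)
    have h2 : (n:ℝ) ≤ n ^ 3 := le_self_pow₀ (by linarith) (by norm_num)
    have h3 := mul_le_mul_of_nonneg_right h1 hlam
    have h4 := mul_le_mul_of_nonneg_right h2 (Real.sqrt_nonneg lam)
    rw [hl]
    linarith
  refine (iota_le G n (by omega) (4 * ∑ v, β v)
    (by have := Finset.sum_nonneg fun v (_ : v ∈ Finset.univ) => hβ0 v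
        linarith) (fun i => {v | t i < h i v}) htne ?_ htb).trans (by gcongr)
  intro i j hij
  rw [Set.disjoint_left]
  intro v hvi hvj
  simp only [Set.mem_ofPred_eq] at hvi hvj
  have h1 : c v ∈ T i := by
    by_contra hc; simp only [h, if_neg hc] at hvi; linarith [ht0 i]
  have h2 : c v ∈ T j := by
    by_contra hc; simp only [h, if_neg hc] at hvj; linarith [ht0 j]
  exact Finset.disjoint_left.1 (hT2 i (by omega) j (by omega) (fun hc => hij (Fin.ext hc))) h1 h2

theorem higher_order_BHT :
    ∃ C : ℝ, 0 < C ∧ ∀ (V : Type*) [Fintype V] [DecidableEq V] (G : SimpleGraph V)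
      [DecidableRel G.Adj] (d : ℕ), G.IsRegularOfDegree d →
      ∀ (n : ℕ) (hn : 2 ≤ n) (hcard : n ≤ Fintype.card V),
        C * (n : ℝ) ^ 6 * lapEigenSorted G ⟨n - 1, by omega⟩
          ≥ (Real.sqrt (multiIota G n / n + 1) - 1) ^ 2 := by
  refine ⟨78 ^ 2, by norm_num, ?_⟩
  intro V _ _ G _ d _ n hn hcard
  set lam := lapEigenSorted G ⟨n - 1, by omega⟩ with hlamdef
  set H := (SimpleGraph.posSemidef_lapMatrix ℝ G).isHermitian with hH
  let e : Fin n → V := fun k => (Fintype.equivOfCardEq (Fintype.card_fin _))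
    (Tuple.sort H.eigenvalues₀ ⟨k, by omega⟩)
  have he : Function.Injective e := by
    intro k l hkl
    have := (Tuple.sort H.eigenvalues₀).injective ((Equiv.injective _) hkl)
    simpa [Fin.ext_iff] using this
  have hev : ∀ k : Fin n, H.eigenvalues (e k) ≤ lam := by
    intro k
    have h1 : H.eigenvalues (e k) = lapEigenSorted G ⟨k, by omega⟩ := by
      simp [Matrix.IsHermitian.eigenvalues, e, lapEigenSorted]
    rw [h1]
    exact Tuple.monotone_sort H.eigenvalues₀ (by simp [Fin.le_def]; omega)
  have hlam : 0 ≤ lam :=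
    ((SimpleGraph.posSemidef_lapMatrix ℝ G).eigenvalues_nonneg (e ⟨0, by omega⟩)).trans (hev _)
  have hon : Orthonormal ℝ (fun k => H.eigenvectorBasis (e k)) :=
    H.eigenvectorBasis.orthonormal.comp e he
  let f : Fin n → V → ℝ := fun k v => H.eigenvectorBasis (e k) v
  have hff : ∀ k l, ∑ v, f k v * f l v = if k = l then 1 else 0 := by
    intro k l
    rw [← (orthonormal_iff_ite.1 hon) k l, PiLp.inner_apply]
    refine Finset.sum_congr rfl fun v _ => ?_
    simp [f, mul_comm]
  have hen : ∀ k, ∑ v, ∑ u, (if G.Adj v u then (f k v - f k u) ^ 2 else 0) ≤ 2 * lam := by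
    intro k
    have h1 := SimpleGraph.lapMatrix_toLinearMap₂' ℝ G (f k)
    rw [Matrix.toLinearMap₂'_apply'] at h1
    have h2 : (SimpleGraph.lapMatrix ℝ G).mulVec (f k) = H.eigenvalues (e k) • f k :=
      H.mulVec_eigenvectorBasis (e k)
    rw [h2, dotProduct_smul] at h1
    have h3 : f k ⬝ᵥ f k = 1 := by simpa [dotProduct] using hff k k
    rw [h3, smul_eq_mul, mul_one] at h1
    have := hev k
    linarith
  let F : V → EuclideanSpace ℝ (Fin n) := fun v => WithLp.toLp 2 (fun k => f k v)
  have hF : ∀ v k, F v k = f k v := fun v k => rfl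
  have hcore := core G n hn F ?_ ?_ lam hlam ?_
  · have hn0 : (0:ℝ) < n := by exact_mod_cast (by omega : 0 < n)
    set s := (n:ℝ) ^ 3 * √lam with hs
    have hs0 : 0 ≤ s := by positivity
    have hx : multiIota G n / n ≤ 24 * s ^ 2 + 156 * s := by
      rw [div_le_iff₀ hn0]; linarith
    have hx0 : 0 ≤ multiIota G n / n := by
      apply div_nonneg _ hn0.le
      apply Real.sInf_nonneg
      rintro y ⟨Q, -, rfl⟩
      exact Real.iSup_nonneg fun i => by positivity
    have h1 : √(multiIota G n / n + 1) ≤ 1 + 78 * s := by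
      apply Real.sqrt_le_iff.2 ⟨by positivity, ?_⟩
      nlinarith [sq_nonneg s]
    have h2 : 1 ≤ √(multiIota G n / n + 1) := by
      apply Real.le_sqrt_of_sq_le; linarith
    have h3 : (√(multiIota G n / n + 1) - 1) ^ 2 ≤ (78 * s) ^ 2 :=
      pow_le_pow_left₀ (by linarith) (by linarith) 2
    have h4 : (78 * s) ^ 2 = 78 ^ 2 * (n:ℝ) ^ 6 * lam := by
      rw [hs, mul_pow, mul_pow, Real.sq_sqrt hlam]; ring
    rw [h4] at h3
    exact h3
  · intro y
    have h1 : ∀ v, (inner ℝ (F v) y) ^ 2 = ∑ k, ∑ l, y k * y l * (f k v * f l v) := by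
      intro v
      rw [PiLp.inner_apply, sq, Finset.sum_mul_sum]
      refine Finset.sum_congr rfl fun k _ => Finset.sum_congr rfl fun l _ => ?_
      simp [hF]; ring
    simp_rw [h1]
    rw [Finset.sum_comm]
    simp_rw [Finset.sum_comm (s := (Finset.univ : Finset V)), ← Finset.mul_sum, hff]
    rw [EuclideanSpace.norm_sq_eq]
    simp [sq]
  · simp_rw [EuclideanSpace.norm_sq_eq]
    rw [Finset.sum_comm]
    have : ∀ k, ∑ v, ‖F v k‖ ^ 2 = 1 := by
      intro k
      have := hff k k
      simpa [hF, sq] using this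
    simp_rw [this]
    simp
  · have h1 : ∀ v u, (if G.Adj v u then ‖F u - F v‖ ^ 2 else 0)
        = ∑ k, (if G.Adj v u then (f k v - f k u) ^ 2 else 0) := by
      intro v u
      split_ifs
      · rw [EuclideanSpace.norm_sq_eq]
        refine Finset.sum_congr rfl fun k _ => ?_
        rw [PiLp.sub_apply, hF, hF, Real.norm_eq_abs, sq_abs]; ring
      · simp
    simp_rw [h1]
    have h2 : ∑ v, ∑ u, ∑ k, (if G.Adj v u then (f k v - f k u) ^ 2 else 0)
        = ∑ k, ∑ v, ∑ u, (if G.Adj v u then (f k v - f k u) ^ 2 else 0) := by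
      calc _ = ∑ v, ∑ k, ∑ u, (if G.Adj v u then (f k v - f k u) ^ 2 else 0) :=
            Finset.sum_congr rfl fun v _ => Finset.sum_comm
        _ = _ := Finset.sum_comm
    rw [h2]
    refine (Finset.sum_le_sum fun k _ => hen k).trans (le_of_eq ?_)
    simp; ring

end Multiway
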